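/- Let D be the center of an A₄⁸(1)-polytope in Pic S₈ (the sum of five distinct lines pairwise intersecting in 1). Then there is a unique pair (A_D, l_D) where l_D is a line and A_D is the center of some cornered A₃⁸(1)-polytope such that D = A_D + l_D; moreover the line l′ := K + A_D/2 associated to A_D satisfies l′·l_D = 1, and the assignment D ↦ (l′, l_D) is a bijection from the set of centers of A₄⁸(1)-polytopes onto the set of ordered pairs (m₁, m₂) of lines with m₁·m₂ = 1. -/

import Mathlib

/-!
Picard lattice of the degree 1 del Pezzo surface S₈:
Pic S₈ = ℤh ⊕ ℤe₁ ⊕ ⋯ ⊕ ℤe₈ ≅ ℤ⁹, with intersection pairing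
h·h = 1, h·eᵢ = 0, eᵢ·eⱼ = −δᵢⱼ, and canonical class K = −3h + e₁ + ⋯ + e₈.
-/

namespace DelPezzo

/-- The Picard lattice `Pic S₈ ≅ ℤ⁹`; coordinate `0` is the `h`-coordinate and
coordinates `1,…,8` are the `e₁,…,e₈`-coordinates. -/
abbrev Pic : Type := Fin 9 → ℤ

/-- The intersection pairing on `Pic S₈` (signature `(1,-8)`). -/
def inter (x y : Pic) : ℤ := x 0 * y 0 - ∑ i : Fin 8, x i.succ * y i.succ

/-- The canonical class `K = -3h + e₁ + ⋯ + e₈`. -/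
def K : Pic := fun i => if i = 0 then -3 else 1

/-- A line: a class `l` with `l·l = -1` and `l·K = -1`. -/
def IsLine (l : Pic) : Prop := inter l l = -1 ∧ inter l K = -1

/-- Centers of `A₄⁸(1)`-polytopes: sums of five distinct lines pairwise intersecting in `1`. -/
def IsCenterA4 (D : Pic) : Prop :=
  ∃ l : Fin 5 → Pic, Function.Injective l ∧ (∀ i, IsLine (l i)) ∧
    (∀ i j, i ≠ j → inter (l i) (l j) = 1) ∧ D = ∑ i, l i

/-- Centers of cornered `A₃⁸(1)`-polytopes. -/
def IsCenterCorneredA3 (A : Pic) : Prop :=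
  ∃ l : Fin 4 → Pic, Function.Injective l ∧ (∀ i, IsLine (l i)) ∧
    (∀ i j, i ≠ j → inter (l i) (l j) = 1) ∧
    (∃ m : Pic, IsLine m ∧ ∀ i, inter m (l i) = 0) ∧ A = ∑ i, l i

lemma inter_eq (x y : Pic) : inter x y = x 0 * y 0 - (x 1 * y 1 + x 2 * y 2 + x 3 * y 3 +
    x 4 * y 4 + x 5 * y 5 + x 6 * y 6 + x 7 * y 7 + x 8 * y 8) := by
  simp only [inter, Fin.sum_univ_eight]
  rfl

lemma inter_comm (x y : Pic) : inter x y = inter y x := by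
  simp only [inter, mul_comm]

lemma inter_add_left (x y z : Pic) : inter (x + y) z = inter x z + inter y z := by
  simp only [inter_eq, Pi.add_apply]; ring

lemma inter_add_right (x y z : Pic) : inter x (y + z) = inter x y + inter x z := by
  simp only [inter_eq, Pi.add_apply]; ring

lemma inter_sub_left (x y z : Pic) : inter (x - y) z = inter x z - inter y z := by
  simp only [inter_eq, Pi.sub_apply]; ring

lemma inter_sub_right (x y z : Pic) : inter x (y - z) = inter x y - inter x z := by
  simp only [inter_eq, Pi.sub_apply]; ring

lemma inter_smul_left (c : ℤ) (x y : Pic) : inter (c • x) y = c * inter x y := by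
  simp only [inter_eq, Pi.smul_apply, smul_eq_mul]; ring

lemma inter_smul_right (c : ℤ) (x y : Pic) : inter x (c • y) = c * inter x y := by
  simp only [inter_eq, Pi.smul_apply, smul_eq_mul]; ring

lemma inter_sum_left {ι : Type*} (s : Finset ι) (f : ι → Pic) (y : Pic) :
    inter (∑ i ∈ s, f i) y = ∑ i ∈ s, inter (f i) y :=
  map_sum (AddMonoidHom.mk' (inter · y) fun a b => inter_add_left a b y) f s

lemma inter_sum_right {ι : Type*} (s : Finset ι) (x : Pic) (f : ι → Pic) :
    inter x (∑ i ∈ s, f i) = ∑ i ∈ s, inter x (f i) :=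
  map_sum (AddMonoidHom.mk' (inter x) (inter_add_right x)) f s

lemma inter_K_K : inter K K = 1 := by decide

lemma inter_K_right (x : Pic) : inter x K =
    -(3 * x 0 + (x 1 + x 2 + x 3 + x 4 + x 5 + x 6 + x 7 + x 8)) := by
  simp [inter_eq, K]; ring

/-- The canonical class is characteristic for the intersection form. -/
lemma even_inter_self_of_inter_K {x : Pic} (hx : inter x K = 0) : Even (inter x x) := by
  have parity (a : ℤ) : ∃ k, a * a = a + 2 * k := by
    obtain ⟨k, hk⟩ := Int.even_mul_pred_self a
    exact ⟨k, by linarith⟩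
  choose k hk using parity
  rw [inter_K_right] at hx
  rw [inter_eq, even_iff_two_dvd]
  simp only [hk]
  omega

/-- A quantitative form of the Hodge index theorem on `Pic S₈`. -/
lemma sq_le_of_inter_K {x : Pic} (hx : inter x K = 0) : x 0 ^ 2 ≤ -8 * inter x x := by
  rw [inter_K_right] at hx
  rw [inter_eq]
  have h0 : 9 * x 0 ^ 2 = (x 1 + x 2 + x 3 + x 4 + x 5 + x 6 + x 7 + x 8) ^ 2 := by
    have : 3 * x 0 = -(x 1 + x 2 + x 3 + x 4 + x 5 + x 6 + x 7 + x 8) := by linarith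
    linear_combination (3 * x 0 - (x 1 + x 2 + x 3 + x 4 + x 5 + x 6 + x 7 + x 8)) * this
  have cs := sq_sum_le_card_mul_sum_sq (s := Finset.univ) (f := fun i : Fin 8 => x i.succ)
  simp only [Fin.sum_univ_eight] at cs
  change (x 1 + x 2 + x 3 + x 4 + x 5 + x 6 + x 7 + x 8) ^ 2 ≤ 8 * (x 1 ^ 2 + x 2 ^ 2 +
    x 3 ^ 2 + x 4 ^ 2 + x 5 ^ 2 + x 6 ^ 2 + x 7 ^ 2 + x 8 ^ 2) at cs
  linarith

/-- The intersection form is negative semidefinite on the orthogonal complement of `K`. -/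
lemma inter_self_nonpos {x : Pic} (hx : inter x K = 0) : inter x x ≤ 0 := by
  linarith [sq_le_of_inter_K hx, sq_nonneg (x 0)]

/-- The intersection form is anisotropic on the orthogonal complement of `K`. -/
lemma eq_zero_of_inter_self {x : Pic} (hx : inter x K = 0) (h : inter x x = 0) : x = 0 := by
  have hz := sq_le_of_inter_K hx
  rw [h, mul_zero] at hz
  rw [inter_eq] at h
  have hs (i : Fin 9) : x i ^ 2 = 0 := by
    refine le_antisymm ?_ (sq_nonneg _)
    fin_cases i <;> simp only [Fin.reduceFinMk, Fin.zero_eta, Fin.mk_one] <;>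
    linarith [sq_nonneg (x 1), sq_nonneg (x 2), sq_nonneg (x 3), sq_nonneg (x 4),
      sq_nonneg (x 5), sq_nonneg (x 6), sq_nonneg (x 7), sq_nonneg (x 8)]
  ext i
  exact (pow_eq_zero_iff two_ne_zero).mp (hs i)

/-- The roots of the `E₈`-lattice `K^⊥`. -/
def IsRoot (x : Pic) : Prop := inter x x = -2 ∧ inter x K = 0

lemma IsLine.isRoot {l : Pic} (h : IsLine l) : IsRoot (l + K) := by
  obtain ⟨h1, h2⟩ := h
  constructor <;>
    simp only [inter_add_left, inter_add_right, inter_comm K l, inter_K_K, h1, h2] <;> norm_num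

lemma IsRoot.isLine {x : Pic} (h : IsRoot x) : IsLine (x - K) := by
  obtain ⟨h1, h2⟩ := h
  constructor <;>
    simp only [inter_sub_left, inter_sub_right, inter_comm K x, inter_K_K, h1, h2] <;> norm_num

lemma IsRoot.inter_sub_K {x y : Pic} (hx : IsRoot x) (hy : IsRoot y) :
    inter (x - K) (y - K) = inter x y + 1 := by
  simp only [inter_sub_left, inter_sub_right, inter_comm K y, inter_K_K, hx.2, hy.2]
  norm_num

lemma IsLine.inter_add_K {l m : Pic} (hl : IsLine l) (hm : IsLine m) :
    inter (l + K) (m + K) = inter l m - 1 := by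
  simp only [inter_add_left, inter_add_right, inter_comm K m, inter_K_K, hl.2, hm.2]
  ring

/-- The reflection in a root. -/
def reflect (a x : Pic) : Pic := x + inter x a • a

lemma inter_reflect {a : Pic} (ha : IsRoot a) (x y : Pic) :
    inter (reflect a x) (reflect a y) = inter x y := by
  simp only [reflect, inter_add_left, inter_add_right, inter_smul_left, inter_smul_right, ha.1,
    inter_comm a y]
  ring

lemma reflect_reflect {a : Pic} (ha : IsRoot a) (x : Pic) : reflect a (reflect a x) = x := by
  simp only [reflect, inter_add_left, inter_smul_left, ha.1]
  module

lemma IsRoot.reflect {a x : Pic} (ha : IsRoot a) (hx : IsRoot x) : IsRoot (reflect a x) := by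
  refine ⟨(inter_reflect ha x x).trans hx.1, ?_⟩
  rw [DelPezzo.reflect, inter_add_left, inter_smul_left, ha.2, hx.2, mul_zero, add_zero]

/-- Four pairwise orthogonal roots, all orthogonal to `r`, with sum `2m`. -/
def Splits (m r : Pic) : Prop :=
  ∃ v : Fin 4 → Pic, (∀ i, IsRoot (v i)) ∧ (∀ i j, i ≠ j → inter (v i) (v j) = 0) ∧
    (∀ i, inter (v i) r = 0) ∧ ∑ i, v i = (2 : ℤ) • m

lemma Splits.of_reflect {a m r : Pic} (ha : IsRoot a)
    (h : Splits (reflect a m) (reflect a r)) : Splits m r := by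
  obtain ⟨v, h1, h2, h3, h4⟩ := h
  refine ⟨fun i => reflect a (v i), fun i => ha.reflect (h1 i),
    fun i j hij => (inter_reflect ha _ _).trans (h2 i j hij), fun i => ?_, ?_⟩
  · rw [← h3 i, ← inter_reflect ha (v i), reflect_reflect ha]
  · have : ∑ i, reflect a (v i) = reflect a (∑ i, v i) := by
      simp only [reflect, Finset.sum_add_distrib, inter_sum_left, Finset.sum_smul]
    rw [this, h4, ← reflect_reflect ha m]
    simp only [reflect, inter_smul_left, inter_add_left, ha.1]
    module

/-- A Weyl vector for the simple roots `simpleRoot`. -/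
def weyl : Pic := ![-68, 22, 23, 24, 25, 26, 27, 28, 29]

/-- The simple roots `h - e₁ - e₂ - e₃` and `eᵢ - eᵢ₊₁`. -/
def simpleRoot : Fin 8 → Pic :=
  ![![1, -1, -1, -1, 0, 0, 0, 0, 0], ![0, 1, -1, 0, 0, 0, 0, 0, 0], ![0, 0, 1, -1, 0, 0, 0, 0, 0],
    ![0, 0, 0, 1, -1, 0, 0, 0, 0], ![0, 0, 0, 0, 1, -1, 0, 0, 0], ![0, 0, 0, 0, 0, 1, -1, 0, 0],
    ![0, 0, 0, 0, 0, 0, 1, -1, 0], ![0, 0, 0, 0, 0, 0, 0, 1, -1]]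

lemma isRoot_simpleRoot (i : Fin 8) : IsRoot (simpleRoot i) := by
  unfold IsRoot
  revert i
  decide

lemma inter_simpleRoot_weyl (i : Fin 8) : inter (simpleRoot i) weyl = 1 := by
  revert i
  decide

/-- To prove a property of all roots, it is enough to prove it for dominant roots and to
propagate it along simple reflections. -/
lemma IsRoot.induction_dominant (s : Set (Fin 8)) {P : Pic → Prop}
    (step : ∀ x, IsRoot x → ∀ i ∈ s, P (DelPezzo.reflect (simpleRoot i) x) → P x)
    (dominant : ∀ x, IsRoot x → (∀ i ∈ s, 0 ≤ inter x (simpleRoot i)) → P x)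
    {x : Pic} (hx : IsRoot x) : P x := by
  have bound {y : Pic} (hy : IsRoot y) : 0 ≤ 2 + 2 * inter y weyl - inter weyl weyl := by
    have hK : inter weyl K = 0 := by decide
    have := inter_self_nonpos (x := y - weyl) (by rw [inter_sub_left, hy.2, hK, sub_zero])
    simp only [inter_sub_left, inter_sub_right, hy.1, inter_comm weyl y] at this
    linarith
  induction hn : (2 + 2 * inter x weyl - inter weyl weyl).toNat using Nat.strong_induction_on
    generalizing x with
  | _ n ih =>
    by_cases hdom : ∀ i ∈ s, 0 ≤ inter x (simpleRoot i)
    · exact dominant x hx hdom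
    · push Not at hdom
      obtain ⟨i, hi, hneg⟩ := hdom
      have hr := (isRoot_simpleRoot i).reflect hx
      refine step x hx i hi (ih _ ?_ hr rfl)
      have h1 := bound hx
      have h2 := bound hr
      have h3 : inter (DelPezzo.reflect (simpleRoot i) x) weyl =
          inter x weyl + inter x (simpleRoot i) := by
        rw [DelPezzo.reflect, inter_add_left, inter_smul_left, inter_simpleRoot_weyl, mul_one]
      omega

/-- The dominant root of `E₈`. -/
def highestRoot : Pic := ![-3, 1, 1, 1, 1, 1, 1, 1, 2]

/-- The dominant root of the `E₇`-lattice orthogonal to `highestRoot`. -/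
def highestRootE7 : Pic := ![-2, 0, 1, 1, 1, 1, 1, 1, 0]

lemma IsRoot.inter_ge {x y : Pic} (hx : IsRoot x) (hy : IsRoot y) : -2 ≤ inter x y := by
  have := inter_self_nonpos (x := x - y) (by rw [inter_sub_left, hx.2, hy.2, sub_zero])
  simp only [inter_sub_left, inter_sub_right, hx.1, hy.1, inter_comm y x] at this
  linarith

lemma IsRoot.eq_of_inter {x y : Pic} (hx : IsRoot x) (hy : IsRoot y) (h : inter x y = -2) :
    x = y := by
  refine sub_eq_zero.mp (eq_zero_of_inter_self ?_ ?_)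
  · rw [inter_sub_left, hx.2, hy.2, sub_zero]
  · simp only [inter_sub_left, inter_sub_right, hx.1, hy.1, inter_comm y x, h]
    norm_num

lemma IsRoot.exists_ne_zero {x : Pic} (hx : IsRoot x) : ∃ i, x i ≠ 0 := by
  by_contra! h
  have := hx.1
  simp [inter_eq, h] at this

lemma isRoot_highestRoot : IsRoot highestRoot := by
  unfold IsRoot
  decide

lemma isRoot_highestRootE7 : IsRoot highestRootE7 := by
  unfold IsRoot
  decide

lemma IsRoot.eq_highestRoot {x : Pic} (hx : IsRoot x)
    (h : ∀ i, 0 ≤ inter x (simpleRoot i)) : x = highestRoot := by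
  refine hx.eq_of_inter isRoot_highestRoot ?_
  have hge := hx.inter_ge isRoot_highestRoot
  have hK := hx.2
  have hne := hx.exists_ne_zero
  simp only [inter_K_right] at hK
  simp [inter_eq, highestRoot] at hge ⊢
  simp [Fin.forall_fin_succ, inter_eq, simpleRoot] at h
  simp [Fin.exists_fin_succ] at hne
  have expand : x 8 = 3 * (x 0 + x 1 + x 2 + x 3) + 2 * (x 2 - x 1) + 4 * (x 3 - x 2) +
      6 * (x 4 - x 3) + 5 * (x 5 - x 4) + 4 * (x 6 - x 5) + 3 * (x 7 - x 6) + 2 * (x 8 - x 7) := by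
    linarith
  by_contra hlt
  have hle : x 8 ≤ 1 := by omega
  have h2 : x 2 = x 1 := by omega
  have h3 : x 3 = x 2 := by omega
  have h4 : x 4 = x 3 := by omega
  have h5 : x 5 = x 4 := by omega
  have h6 : x 6 = x 5 := by omega
  have h7 : x 7 = x 6 := by omega
  have h8 : x 8 = x 7 := by omega
  omega

lemma IsRoot.eq_highestRootE7 {x : Pic} (hx : IsRoot x) (horth : inter highestRoot x = 0)
    (h : ∀ i ≠ 7, 0 ≤ inter x (simpleRoot i)) : x = highestRootE7 := by
  refine hx.eq_of_inter isRoot_highestRootE7 ?_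
  have hge := hx.inter_ge isRoot_highestRootE7
  have hK := hx.2
  have hne := hx.exists_ne_zero
  simp only [inter_K_right] at hK
  simp [inter_eq, highestRootE7] at hge ⊢
  simp [inter_eq, highestRoot] at horth
  simp [Fin.forall_fin_succ, inter_eq, simpleRoot] at h
  simp [Fin.exists_fin_succ] at hne
  omega

lemma splits_highestRoot : Splits highestRoot highestRootE7 := by
  refine ⟨![![-2, 1, 0, 0, 1, 1, 1, 1, 1], ![-2, 1, 1, 1, 0, 0, 1, 1, 1],
    ![-1, 0, 0, 1, 0, 1, 0, 0, 1], ![-1, 0, 1, 0, 1, 0, 0, 0, 1]], ?_, ?_, ?_, ?_⟩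
  · unfold IsRoot
    decide
  all_goals decide

lemma IsRoot.splits {m r : Pic} (hm : IsRoot m) (hr : IsRoot r) (h : inter m r = 0) :
    Splits m r := by
  have key : ∀ r, IsRoot r → inter highestRoot r = 0 → Splits highestRoot r := by
    intro r hr
    refine hr.induction_dominant {i | i ≠ 7} (P := fun r => inter highestRoot r = 0 →
      Splits highestRoot r) (fun x _ i hi hP hx => ?_) (fun x hx hdom horth => ?_)
    · have hfix : DelPezzo.reflect (simpleRoot i) highestRoot = highestRoot := by
        have : ∀ i : Fin 8, i ≠ 7 → inter highestRoot (simpleRoot i) = 0 := by decide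
        simp [DelPezzo.reflect, this i hi]
      refine Splits.of_reflect (isRoot_simpleRoot i) ?_
      rw [hfix]
      refine hP ?_
      rw [← hx, ← inter_reflect (isRoot_simpleRoot i) highestRoot x, hfix]
    · exact hx.eq_highestRootE7 horth hdom ▸ splits_highestRoot
  refine hm.induction_dominant Set.univ (P := fun m => ∀ r, IsRoot r → inter m r = 0 → Splits m r)
    (fun x _ i _ hP r hr h => ?_) (fun x hx hdom => ?_) r hr h
  · have ha := isRoot_simpleRoot i
    exact Splits.of_reflect ha (hP _ (ha.reflect hr) ((inter_reflect ha x r).trans h))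
  · exact hx.eq_highestRoot (fun i => hdom i trivial) ▸ key

/-- Among five pairwise orthogonal roots, four have sum divisible by two: modulo two, five
pairwise orthogonal isotropic vectors in a nine-dimensional space are linearly dependent. -/
lemma exists_sum_succAbove_eq_two_smul {r : Fin 5 → Pic} (hr : ∀ i, IsRoot (r i))
    (horth : ∀ i j, i ≠ j → inter (r i) (r j) = 0) :
    ∃ (j : Fin 5) (v : Pic), ∑ i, r (j.succAbove i) = (2 : ℤ) • v := by
  let A : Matrix (Fin 5) (Fin 9) (ZMod 2) := fun i k => (r i k : ZMod 2)
  have hA : A * A.transpose = 0 := by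
    ext i j
    have h1 : A i ⬝ᵥ A j = (inter (r i) (r j) : ZMod 2) := by
      rw [inter, dotProduct, Fin.sum_univ_succ]
      push_cast
      rw [CharTwo.sub_eq_add]
    change A i ⬝ᵥ A j = 0
    rw [h1]
    by_cases hij : i = j
    · rw [hij, (hr j).1]; rfl
    · rw [horth i j hij]; rfl
  have hdep : ¬ LinearIndependent (ZMod 2) A.row := fun hli => by
    have := Matrix.rank_add_rank_le_card_of_mul_eq_zero hA
    rw [Matrix.rank_transpose, hli.rank_matrix] at this
    simp at this
  obtain ⟨g, hg, i₀, hi₀⟩ := Fintype.not_linearIndependent_iff.mp hdep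
  let b : Fin 5 → ℤ := fun i => (g i).val
  have hbg (i : Fin 5) : (b i : ZMod 2) = g i := by simp [b]
  have hb (i : Fin 5) : b i = 0 ∨ b i = 1 := by
    have := (g i).val_lt
    simp only [b]
    omega
  have hb₀ : b i₀ ≠ 0 := fun h => hi₀ (by rw [← hbg, h, Int.cast_zero])
  have hdvd (k : Fin 9) : ∃ c, (∑ i, b i • r i) k = 2 * c := by
    refine (ZMod.intCast_zmod_eq_zero_iff_dvd _ 2).mp ?_
    have := congrFun hg k
    simp only [Finset.sum_apply, Pi.smul_apply, smul_eq_mul, Int.cast_sum, Int.cast_mul,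
      hbg] at this ⊢
    exact this
  choose v hv using hdvd
  have hv' : ∑ i, b i • r i = (2 : ℤ) • v := funext hv
  have hvK : inter v K = 0 := by
    have := congrArg (inter · K) hv'
    simp only [inter_sum_left, inter_smul_left, (hr _).2, mul_zero, Finset.sum_const_zero] at this
    omega
  have hnorm : -2 * ∑ i, b i = 4 * inter v v := by
    have hin (i : Fin 5) : inter (∑ j, b j • r j) (b i • r i) = -2 * b i := by
      rw [inter_sum_left, Finset.sum_eq_single i]
      · rw [inter_smul_left, inter_smul_right, (hr i).1]
        rcases hb i with h | h <;> rw [h] <;> norm_num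
      · intro j _ hj
        rw [inter_smul_left, inter_smul_right, horth j i hj, mul_zero, mul_zero]
      · simp
    calc -2 * ∑ i, b i = inter (∑ i, b i • r i) (∑ i, b i • r i) := by
          rw [inter_sum_right, Finset.mul_sum]
          exact (Finset.sum_congr rfl fun i _ => hin i).symm
      _ = 4 * inter v v := by
          rw [hv', inter_smul_left, inter_smul_right]
          ring
  obtain ⟨k, hk⟩ := even_inter_self_of_inter_K hvK
  have hone : ∃ j, b j = 0 ∧ ∀ i, b (j.succAbove i) = 1 := by
    have hs : ∑ i, b i = 4 := by
      have h0 : b i₀ ≤ ∑ i, b i := Finset.single_le_sum (f := b) (s := Finset.univ)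
        (fun i _ => by rcases hb i with h | h <;> omega) (Finset.mem_univ i₀)
      have h5 : ∑ i, b i ≤ 5 := Finset.sum_le_card_nsmul Finset.univ b 1
        (fun i _ => by rcases hb i with h | h <;> omega)
      rcases hb i₀ with h | h <;> omega
    obtain ⟨j, hj⟩ : ∃ j, b j = 0 := by
      by_contra! h
      have : ∀ i, b i = 1 := fun i => (hb i).resolve_left (h i)
      simp [this] at hs
    refine ⟨j, hj, fun i => (hb _).resolve_left fun hi => ?_⟩
    rw [Fin.sum_univ_succAbove _ j, hj, zero_add, Fin.sum_univ_succAbove _ i, hi, zero_add] at hs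
    have := Finset.sum_le_card_nsmul Finset.univ (fun k => b (j.succAbove (i.succAbove k))) 1
        (fun k _ => by rcases hb (j.succAbove (i.succAbove k)) with h | h <;> omega)
    simp at this
    omega
  obtain ⟨j, hj, hj'⟩ := hone
  refine ⟨j, v, ?_⟩
  rw [← hv', Fin.sum_univ_succAbove _ j, hj]
  simp [hj']

lemma IsCenterCorneredA3.exists_line {A : Pic} (h : IsCenterCorneredA3 A) :
    ∃ m, IsLine m ∧ A = (2 : ℤ) • m - (2 : ℤ) • K := by
  obtain ⟨l, -, hl, hll, ⟨m, hm, hml⟩, rfl⟩ := h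
  refine ⟨m, hm, (sub_eq_zero.mp (eq_zero_of_inter_self ?_ ?_))⟩
  · simp only [inter_sub_left, inter_sum_left, inter_smul_left, (hl _).2, hm.2, inter_K_K]
    simp
  · have h1 (i : Fin 4) : ∑ j, inter (l j) (l i) = 2 := by
      rw [Fin.sum_univ_succAbove _ i, (hl i).1]
      simp [hll _ _ (Fin.succAbove_ne i _)]
    have h2 : inter (∑ i, l i) (∑ i, l i) = 8 := by
      rw [inter_sum_right]
      simp only [inter_sum_left, h1]
      simp
    have h3 : inter (∑ i, l i) K = -4 := by
      simp [inter_sum_left, (hl _).2]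
    have h4 : inter m (∑ i, l i) = 0 := by
      simp [inter_sum_right, hml]
    simp only [inter_sub_left, inter_sub_right, inter_smul_left, inter_smul_right, h2, h3, h4,
      inter_comm (∑ i, l i) m, inter_comm K (∑ i, l i), inter_comm K m, hm.1, hm.2, inter_K_K]
    norm_num

lemma inter_corner_of_isCenterA4 {m l : Pic} (hm : IsLine m) (hl : IsLine l)
    (h : IsCenterA4 ((2 : ℤ) • m - (2 : ℤ) • K + l)) : inter m l = 1 := by
  obtain ⟨v, -, hv, hvv, hD⟩ := h
  have h1 (i : Fin 5) : ∑ j, inter (v j) (v i) = 3 := by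
    rw [Fin.sum_univ_succAbove _ i, (hv i).1]
    simp [hvv _ _ (Fin.succAbove_ne i _)]
  have h2 := congrArg (fun x => inter x x) hD
  have h3 : inter (∑ i, v i) (∑ i, v i) = 15 := by
    rw [inter_sum_right]
    simp only [inter_sum_left, h1]
    simp
  simp only [h3, inter_add_left, inter_add_right, inter_sub_left, inter_sub_right,
    inter_smul_left, inter_smul_right, inter_comm K, inter_comm l m, hm.1, hm.2, hl.1, hl.2,
    inter_K_K] at h2
  omega

lemma eq_of_two_smul_add_eq {m l m' l' : Pic} (hm : IsLine m) (hl : IsLine l)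
    (hm' : IsLine m') (hl' : IsLine l') (hml : inter m l = 1)
    (h : (2 : ℤ) • m + l = (2 : ℤ) • m' + l') : m = m' ∧ l = l' := by
  obtain ⟨d, rfl⟩ : ∃ d, m' = m + d := ⟨m' - m, by abel⟩
  obtain rfl : l = l' + (2 : ℤ) • d := by linear_combination (exp := 1) h
  have hmK := hm'.2
  have hmd := hm'.1
  have hlK := hl.2
  have hld := hl.1
  simp only [inter_add_left, inter_add_right, inter_smul_left, inter_smul_right, hm.1, hm.2,
    hl'.1, hl'.2, inter_comm d m, inter_comm d l'] at hmK hmd hlK hld hml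
  have hdK : inter d K = 0 := by omega
  have hwK : inter (l' + d + K) K = 0 := by
    simp only [inter_add_left, hl'.2, hdK, inter_K_K]
    norm_num
  have hw : inter (l' + d + K) (l' + d + K) = -inter d d - 2 := by
    simp only [inter_add_left, inter_add_right, inter_comm K l', inter_comm K d, inter_comm d l',
      hl'.1, hl'.2, hdK, inter_K_K]
    linarith
  have hw_nonpos := inter_self_nonpos hwK
  have hd_nonpos := inter_self_nonpos hdK
  obtain ⟨k, hk⟩ := even_inter_self_of_inter_K hdK
  obtain hd | hd : inter d d = 0 ∨ inter d d = -2 := by omega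
  · simp [eq_zero_of_inter_self hdK hd]
  · have hzero := congrArg (inter m) (eq_zero_of_inter_self hwK (by omega))
    rw [inter_add_right, inter_add_right, hm.2, show inter m 0 = 0 by simp [inter_eq]] at hzero
    omega

lemma IsCenterA4.exists_lines {D : Pic} (h : IsCenterA4 D) :
    ∃ m l, IsLine m ∧ IsLine l ∧ inter m l = 1 ∧
      IsCenterCorneredA3 ((2 : ℤ) • m - (2 : ℤ) • K) ∧ D = (2 : ℤ) • m - (2 : ℤ) • K + l := by
  have hD := h
  obtain ⟨l, hinj, hl, hll, rfl⟩ := h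
  obtain ⟨j, v, hv⟩ := exists_sum_succAbove_eq_two_smul (r := fun i => l i + K)
    (fun i => (hl i).isRoot) (fun i j hij => by rw [(hl i).inter_add_K (hl j), hll i j hij]; rfl)
  have hvr (i : Fin 4) : inter v (l (j.succAbove i) + K) = -1 := by
    have := congrArg (inter · (l (j.succAbove i) + K)) hv
    simp only [inter_sum_left, inter_smul_left] at this
    rw [Fin.sum_univ_succAbove _ i, (hl _).isRoot.1] at this
    simp only [(hl _).inter_add_K (hl _)] at this
    rw [Finset.sum_eq_zero fun k _ => by
      rw [hll _ _ (by simp [Fin.succAbove_ne]), sub_self]] at this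
    omega
  have hvroot : IsRoot v := by
    constructor
    · have := congrArg (inter v) hv
      simp only [inter_sum_right, inter_smul_right, hvr] at this
      simp at this
      omega
    · have := congrArg (inter · K) hv
      simp only [inter_sum_left, inter_smul_left, (hl _).isRoot.2] at this
      simp at this
      omega
  have hsum : ∑ i, l (j.succAbove i) = (2 : ℤ) • (v - K) - (2 : ℤ) • K := by
    simp only [Finset.sum_add_distrib] at hv
    rw [eq_sub_of_add_eq hv]
    simp only [Finset.sum_const, Finset.card_univ, Fintype.card_fin]
    module
  have hDeq : ∑ i, l i = (2 : ℤ) • (v - K) - (2 : ℤ) • K + l j := by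
    rw [Fin.sum_univ_succAbove _ j, hsum, add_comm]
  refine ⟨v - K, l j, hvroot.isLine, hl j, ?_, ?_, hDeq⟩
  · exact inter_corner_of_isCenterA4 hvroot.isLine (hl j) (hDeq ▸ hD)
  · refine ⟨fun i => l (j.succAbove i), hinj.comp Fin.succAbove_right_injective, fun i => hl _,
      fun i k hik => hll _ _ (Fin.succAbove_right_injective.ne hik),
      ⟨v - K, hvroot.isLine, fun i => ?_⟩, hsum.symm⟩
    have := hvroot.inter_sub_K (hl (j.succAbove i)).isRoot
    rw [hvr, add_sub_cancel_right] at this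
    exact this

lemma isCenterA4_of_lines {m l : Pic} (hm : IsLine m) (hl : IsLine l) (h : inter m l = 1) :
    IsCenterA4 ((2 : ℤ) • m - (2 : ℤ) • K + l) := by
  obtain ⟨v, hv, hvv, hvl, hsum⟩ := hm.isRoot.splits hl.isRoot
    (by rw [hm.inter_add_K hl, h, sub_self])
  have hlines : ∀ i, IsLine ((Fin.cons l fun i => v i - K : Fin 5 → Pic) i) :=
    Fin.cases hl fun i => (hv i).isLine
  have hvl' (i : Fin 4) : inter (v i - K) l = 1 := by
    have := (hv i).inter_sub_K hl.isRoot
    rwa [hvl, add_sub_cancel_right] at this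
  have hinter : ∀ i j, i ≠ j → inter ((Fin.cons l fun i => v i - K : Fin 5 → Pic) i)
      ((Fin.cons l fun i => v i - K : Fin 5 → Pic) j) = 1 := by
    intro i j
    refine Fin.cases ?_ (fun i => ?_) i <;> refine Fin.cases ?_ (fun j => ?_) j <;> intro hij
    · exact absurd rfl hij
    · exact (inter_comm _ _).trans (hvl' j)
    · exact hvl' i
    · exact ((hv i).inter_sub_K (hv j)).trans
        (by rw [hvv i j (by simpa using hij), zero_add])
  refine ⟨_, fun i j hij => ?_, hlines, hinter, ?_⟩
  · by_contra hne
    have := hinter i j hne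
    rw [hij, (hlines j).1] at this
    omega
  · simp only [Fin.sum_univ_succ (n := 4), Fin.cons_zero, Fin.cons_succ,
      Finset.sum_sub_distrib, hsum]
    simp only [Finset.sum_const, Finset.card_univ, Fintype.card_fin]
    module

theorem centers_of_A4_correspond_to_incident_line_pairs :
    (∀ D : Pic, IsCenterA4 D →
      ∃! p : Pic × Pic, IsCenterCorneredA3 p.1 ∧ IsLine p.2 ∧ D = p.1 + p.2) ∧
    ∃ Φ : Pic → Pic × Pic,
      (∀ D : Pic, IsCenterA4 D →
        ∃ A lD : Pic, IsCenterCorneredA3 A ∧ IsLine lD ∧ D = A + lD ∧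
          2 • (Φ D).1 = 2 • K + A ∧ (Φ D).2 = lD ∧ inter (Φ D).1 (Φ D).2 = 1) ∧
      Set.BijOn Φ {D : Pic | IsCenterA4 D}
        {p : Pic × Pic | IsLine p.1 ∧ IsLine p.2 ∧ inter p.1 p.2 = 1} := by
  have unique {m l m' l' : Pic} (hm : IsLine m) (hl : IsLine l) (hm' : IsLine m')
      (hl' : IsLine l') (hml : inter m l = 1)
      (h : (2 : ℤ) • m - (2 : ℤ) • K + l = (2 : ℤ) • m' - (2 : ℤ) • K + l') :
      m = m' ∧ l = l' :=
    eq_of_two_smul_add_eq hm hl hm' hl' hml (by linear_combination (exp := 1) h)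
  constructor
  · intro D hD
    obtain ⟨m, l, hm, hl, hml, hA, rfl⟩ := hD.exists_lines
    refine ⟨(_, l), ⟨hA, hl, rfl⟩, ?_⟩
    rintro ⟨A', l'⟩ ⟨hA', hl', hD'⟩
    obtain ⟨m', hm', rfl⟩ := hA'.exists_line
    obtain ⟨rfl, rfl⟩ := unique hm hl hm' hl' hml hD'
    rfl
  · have hex : ∀ D, ∃ p : Pic × Pic, IsCenterA4 D → IsLine p.1 ∧ IsLine p.2 ∧
        inter p.1 p.2 = 1 ∧ IsCenterCorneredA3 ((2 : ℤ) • p.1 - (2 : ℤ) • K) ∧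
        D = (2 : ℤ) • p.1 - (2 : ℤ) • K + p.2 := by
      intro D
      by_cases hD : IsCenterA4 D
      · obtain ⟨m, l, h⟩ := hD.exists_lines
        exact ⟨(m, l), fun _ => h⟩
      · exact ⟨0, fun h => absurd h hD⟩
    choose Φ hΦ using hex
    refine ⟨Φ, fun D hD => ?_, fun D hD => ?_, fun D hD D' hD' hDD' => ?_, ?_⟩
    · obtain ⟨-, hl, hml, hA, hDeq⟩ := hΦ D hD
      exact ⟨_, _, hA, hl, hDeq, by module, rfl, hml⟩
    · obtain ⟨hm, hl, hml, -⟩ := hΦ D hD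
      exact ⟨hm, hl, hml⟩
    · rw [(hΦ D hD).2.2.2.2, (hΦ D' hD').2.2.2.2, hDD']
    · rintro ⟨m, l⟩ ⟨hm, hl, hml⟩
      have hD := isCenterA4_of_lines hm hl hml
      obtain ⟨hm', hl', -, -, hDeq⟩ := hΦ _ hD
      obtain ⟨h1, h2⟩ := unique hm hl hm' hl' hml hDeq
      exact ⟨_, hD, Prod.ext h1.symm h2.symm⟩

end DelPezzo
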